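/- Let X be a Rado complex, let U ⊆ V(X) be a finite subset and let A ⊆ X_U be a subcomplex. Let Z_{U,A} ⊆ V(X) denote the set of vertices v ∈ V(X) − U satisfying Lk_X(v) ∩ X_U = A. Then Z_{U,A} is infinite and the subcomplex of X induced on Z_{U,A} is a Rado complex. -/

import Mathlib

/-- An (abstract) simplicial complex with vertices drawn from `ℕ`:
a set of nonempty finite subsets of `ℕ` (the simplexes) closed under
passing to nonempty subsets.  The vertex set `V(X)` is the set of `v`
with `{v}` a simplex. -/
structure SComplex where
  faces : Set (Finset ℕ)
  nonempty_of_mem : ∀ s ∈ faces, s.Nonempty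
  down_closed : ∀ s ∈ faces, ∀ t ⊆ s, t.Nonempty → t ∈ faces

namespace SComplex

/-- The vertex set of a simplicial complex. -/
def vertexSet (X : SComplex) : Set ℕ := {v | {v} ∈ X.faces}

/-- The subcomplex of `X` induced on a set `U` of vertices. -/
def induced (X : SComplex) (U : Set ℕ) : SComplex where
  faces := {s | s ∈ X.faces ∧ (↑s : Set ℕ) ⊆ U}
  nonempty_of_mem := fun s hs => X.nonempty_of_mem s hs.1
  down_closed := fun s hs t hts ht =>
    ⟨X.down_closed s hs.1 t hts ht,
     fun x hx => hs.2 (Finset.mem_coe.mpr (hts (Finset.mem_coe.mp hx)))⟩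

/-- The link of a vertex `v`: all simplexes `σ` with `v ∉ σ` and `σ ∪ {v}` a simplex. -/
def link (X : SComplex) (v : ℕ) : SComplex where
  faces := {s | s ∈ X.faces ∧ v ∉ s ∧ insert v s ∈ X.faces}
  nonempty_of_mem := fun s hs => X.nonempty_of_mem s hs.1
  down_closed := fun s hs t hts ht =>
    ⟨X.down_closed s hs.1 t hts ht,
     fun hv => hs.2.1 (hts hv),
     X.down_closed _ hs.2.2 _ (Finset.insert_subset_insert v hts)
       (Finset.insert_nonempty v t)⟩

/-- `IsIso X Y f` : the map `f` is an isomorphism of simplicial complexes from `X` to `Y`,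
i.e. a bijection of the vertex sets which induces a bijection between the sets of simplexes. -/
def IsIso (X Y : SComplex) (f : ℕ → ℕ) : Prop :=
  Set.BijOn f X.vertexSet Y.vertexSet ∧
    ∀ s : Finset ℕ, (↑s : Set ℕ) ⊆ X.vertexSet → (s ∈ X.faces ↔ s.image f ∈ Y.faces)

/-- Two simplicial complexes are isomorphic. -/
def Isomorphic (X Y : SComplex) : Prop := ∃ f, IsIso X Y f

/-- `X` is universal: every countable simplicial complex is isomorphic to an induced
subcomplex of `X`. -/
def Universal (X : SComplex) : Prop :=
  ∀ Y : SComplex, Y.vertexSet.Countable →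
    ∃ U ⊆ X.vertexSet, Isomorphic Y (X.induced U)

/-- `X` is homogeneous: every isomorphism between finite induced subcomplexes of `X`
extends to an isomorphism of `X` onto itself. -/
def Homogeneous (X : SComplex) : Prop :=
  ∀ U U' : Set ℕ, U.Finite → U'.Finite → U ⊆ X.vertexSet → U' ⊆ X.vertexSet →
    ∀ f : ℕ → ℕ, IsIso (X.induced U) (X.induced U') f →
      ∃ F : ℕ → ℕ, IsIso X X F ∧ Set.EqOn F f U

/-- A Rado complex: a countable simplicial complex which is universal and homogeneous. -/
def IsRado (X : SComplex) : Prop :=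
  X.vertexSet.Countable ∧ Universal X ∧ Homogeneous X

/-- The ampleness condition: for every finite `U ⊆ V(X)` and every subcomplex `A` of the
induced complex `X_U` there is a vertex `v ∈ V(X) - U` with `Lk_X(v) ∩ X_U = A`. -/
def AmpleProp (X : SComplex) : Prop :=
  ∀ U : Set ℕ, U.Finite → U ⊆ X.vertexSet →
    ∀ A : SComplex, A.faces ⊆ (X.induced U).faces →
      ∃ v ∈ X.vertexSet \ U, (X.link v).faces ∩ (X.induced U).faces = A.faces

/-- An ample complex: a countable simplicial complex satisfying the ampleness condition. -/
def IsAmple (X : SComplex) : Prop := X.vertexSet.Countable ∧ AmpleProp X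

/-- `L'` is an induced subcomplex of `L`. -/
def IsInduced (L' L : SComplex) : Prop :=
  L'.faces ⊆ L.faces ∧ ∀ s ∈ L.faces, (↑s : Set ℕ) ⊆ L'.vertexSet → s ∈ L'.faces

end SComplex

namespace SComplex

variable {X Y : SComplex}

lemma vertexSet_induced {U : Set ℕ} (hU : U ⊆ X.vertexSet) : (X.induced U).vertexSet = U := by
  ext a
  constructor
  · intro h
    exact h.2 (by simp)
  · intro h
    exact ⟨hU h, by simpa using h⟩

lemma IsIso.mem_faces_iff {W : Set ℕ} {f : ℕ → ℕ} (hf : IsIso X (Y.induced W) f)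
    {s : Finset ℕ} (hs : (s : Set ℕ) ⊆ X.vertexSet) : s ∈ X.faces ↔ s.image f ∈ Y.faces := by
  rw [hf.2 s hs]
  refine ⟨fun h => h.1, fun h => ⟨h, ?_⟩⟩
  intro b hb
  obtain ⟨a, ha, rfl⟩ := Finset.mem_image.1 (Finset.mem_coe.1 hb)
  exact (hf.1.mapsTo (hs ha)).2 (by simp)

/-- For `A ⊆ X` and a new vertex `c`: the complex `X` together with a cone over
the subcomplex `A` with apex `c`. -/
def coneOver (X A : SComplex) (hA : A.faces ⊆ X.faces) (c : ℕ) : SComplex where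
  faces := {s | s.Nonempty ∧ ((c ∉ s ∧ s ∈ X.faces) ∨
    (c ∈ s ∧ (s.erase c ∈ A.faces ∨ s.erase c = ∅)))}
  nonempty_of_mem := fun _ hs => hs.1
  down_closed := by
    rintro s ⟨-, hs⟩ t hts ht
    refine ⟨ht, ?_⟩
    rcases hs with ⟨hcs, hs⟩ | ⟨-, hs⟩
    · exact Or.inl ⟨fun h => hcs (hts h), X.down_closed s hs t hts ht⟩
    have herase : t.erase c ⊆ s.erase c := Finset.erase_subset_erase c hts
    have ht' : t.erase c ∈ A.faces ∨ t.erase c = ∅ := by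
      rcases (t.erase c).eq_empty_or_nonempty with h | h
      · exact Or.inr h
      · exact Or.inl <| A.down_closed _ (hs.resolve_right fun h₀ =>
          h.ne_empty (Finset.subset_empty.1 (h₀ ▸ herase))) _ herase h
    by_cases hct : c ∈ t
    · exact Or.inr ⟨hct, ht'⟩
    · rw [Finset.erase_eq_of_notMem hct] at ht'
      exact Or.inl ⟨hct, hA (ht'.resolve_right ht.ne_empty)⟩

/-- Rado complexes are ample. -/
lemma IsRado.ampleProp (hX : X.IsRado) : AmpleProp X := by
  intro U hUfin hUsub A hA
  obtain ⟨c, hc⟩ := hUfin.exists_notMem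
  let Y := coneOver (X.induced U) A hA c
  have hYU : ∀ s : Finset ℕ, (s : Set ℕ) ⊆ U → (s ∈ Y.faces ↔ s ∈ X.faces) := by
    intro s hs
    have hcs : c ∉ s := fun h => hc (hs h)
    exact ⟨fun h => (h.2.resolve_right fun h => hcs h.1).2.1,
      fun h => ⟨X.nonempty_of_mem s h, Or.inl ⟨hcs, h, hs⟩⟩⟩
  have hYc : ∀ s : Finset ℕ, s.Nonempty → (s : Set ℕ) ⊆ U →
      (insert c s ∈ Y.faces ↔ s ∈ A.faces) := by
    intro s hne hs
    have hcs : c ∉ s := fun h => hc (hs h)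
    change _ ∧ _ ↔ _
    simp [Finset.erase_insert hcs, hne.ne_empty]
  have hcY : c ∈ Y.vertexSet := ⟨by simp, Or.inr (by simp)⟩
  have hUY : U ⊆ Y.vertexSet := fun a ha => (hYU {a} (by simpa using ha)).2 (hUsub ha)
  obtain ⟨W, hW, g, hg⟩ := hX.2.1 Y (Set.to_countable _)
  have hgW := hg.1
  rw [vertexSet_induced hW] at hgW
  have hgU : g '' U ⊆ X.vertexSet := (hgW.mapsTo.mono_left hUY).image_subset.trans hW
  have hiso : IsIso (X.induced U) (X.induced (g '' U)) g := by
    refine ⟨?_, fun s hs => ?_⟩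
    · rw [vertexSet_induced hUsub, vertexSet_induced hgU]
      exact (hgW.injOn.mono hUY).bijOn_image
    · rw [vertexSet_induced hUsub] at hs
      have h := (hYU s hs).symm.trans (hg.mem_faces_iff (hs.trans hUY))
      refine ⟨fun hsX => ⟨h.1 hsX.1, ?_⟩, fun hsX => ⟨h.2 hsX.1, hs⟩⟩
      rw [Finset.coe_image]
      exact Set.image_mono hs
  obtain ⟨F, hF, hFg⟩ := hX.2.2 U (g '' U) hUfin (hUfin.image g) hUsub hgU g hiso
  obtain ⟨v, hvX, hv⟩ := hF.1.surjOn (hW (hgW.mapsTo hcY))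
  have hvU : v ∉ U := by
    intro h
    have := hgW.injOn (hUY h) hcY ((hFg h).symm.trans hv)
    exact hc (this ▸ h)
  have key : ∀ s : Finset ℕ, s.Nonempty → (s : Set ℕ) ⊆ U →
      (insert v s ∈ X.faces ↔ s ∈ A.faces) := by
    intro s hne hs
    have himg : (insert v s).image F = (insert c s).image g := by
      rw [Finset.image_insert, Finset.image_insert, hv]
      congr 1
      exact Finset.image_congr fun a ha => hFg (hs ha)
    rw [← hYc s hne hs, hF.2 _ (by
      rw [Finset.coe_insert]
      exact Set.insert_subset hvX (hs.trans hUsub)), himg, ← hg.mem_faces_iff (by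
      rw [Finset.coe_insert]
      exact Set.insert_subset hcY (hs.trans hUY))]
  refine ⟨v, ⟨hvX, hvU⟩, Set.ext fun s => ⟨?_, fun hs => ?_⟩⟩
  · rintro ⟨hs, hsU⟩
    exact (key s (X.nonempty_of_mem s hs.1) hsU.2).1 hs.2.2
  · have hsU := hA hs
    exact ⟨⟨hsU.1, fun h => hvU (hsU.2 h), (key s (A.nonempty_of_mem s hs) hsU.2).2 hs⟩, hsU⟩

/-- A set of pairs that is the graph of an isomorphism between induced subcomplexes. -/
structure IsPartialIso (X Y : SComplex) (P : Set (ℕ × ℕ)) : Prop where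
  fst_mem : ∀ x ∈ P, x.1 ∈ X.vertexSet
  snd_mem : ∀ x ∈ P, x.2 ∈ Y.vertexSet
  fst_eq_iff : ∀ x ∈ P, ∀ y ∈ P, x.1 = y.1 ↔ x.2 = y.2
  image_mem_iff : ∀ q : Finset (ℕ × ℕ), (q : Set (ℕ × ℕ)) ⊆ P →
    (q.image Prod.fst ∈ X.faces ↔ q.image Prod.snd ∈ Y.faces)

lemma IsPartialIso.swap {P : Set (ℕ × ℕ)} (hP : IsPartialIso X Y P) :
    IsPartialIso Y X (Prod.swap '' P) where
  fst_mem := by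
    rintro _ ⟨x, hx, rfl⟩
    exact hP.snd_mem x hx
  snd_mem := by
    rintro _ ⟨x, hx, rfl⟩
    exact hP.fst_mem x hx
  fst_eq_iff := by
    rintro _ ⟨x, hx, rfl⟩ _ ⟨y, hy, rfl⟩
    exact (hP.fst_eq_iff x hx y hy).symm
  image_mem_iff := by
    intro q hq
    have h := hP.image_mem_iff (q.image Prod.swap) (by
      intro x hx
      obtain ⟨y, hy, rfl⟩ := Finset.mem_image.1 (Finset.mem_coe.1 hx)
      obtain ⟨z, hz, rfl⟩ := hq hy
      simpa using hz)
    simp only [Finset.image_image] at h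
    exact h.symm

lemma IsPartialIso.exists_extend_fst (hY : AmpleProp Y) {P : Set (ℕ × ℕ)}
    (hP : IsPartialIso X Y P) (hfin : P.Finite) {a : ℕ} (ha : a ∈ X.vertexSet) :
    ∃ Q, P ⊆ Q ∧ Q.Finite ∧ IsPartialIso X Y Q ∧ ∃ b, (a, b) ∈ Q := by
  by_cases hdom : ∃ b, (a, b) ∈ P
  · exact ⟨P, subset_rfl, hfin, hP, hdom⟩
  push Not at hdom
  let A : SComplex :=
    { faces := {t | t.Nonempty ∧ ∃ q : Finset (ℕ × ℕ), (q : Set (ℕ × ℕ)) ⊆ P ∧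
        q.image Prod.snd = t ∧ insert a (q.image Prod.fst) ∈ X.faces}
      nonempty_of_mem := fun _ h => h.1
      down_closed := by
        rintro _ ⟨-, q, hq, rfl, hX⟩ t ht hne
        refine ⟨hne, q.filter (fun x => x.2 ∈ t), ?_, ?_, ?_⟩
        · exact fun x hx => hq (Finset.mem_filter.1 (Finset.mem_coe.1 hx)).1
        · ext b
          have := @ht b
          simp only [Finset.mem_image, Finset.mem_filter] at this ⊢
          grind
        · exact X.down_closed _ hX _ (Finset.insert_subset_insert _
            (Finset.image_subset_image (Finset.filter_subset _ _))) (by simp) }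
  have hAsub : A.faces ⊆ (Y.induced (Prod.snd '' P)).faces := by
    rintro _ ⟨hne, q, hq, rfl, hqX⟩
    refine ⟨(hP.image_mem_iff q hq).1 (X.down_closed _ hqX _ (Finset.subset_insert _ _) ?_), ?_⟩
    · simpa using hne
    · rw [Finset.coe_image]
      exact Set.image_mono hq
  obtain ⟨b, ⟨hbY, hbP⟩, hb⟩ := hY (Prod.snd '' P) (hfin.image _)
    (by rintro _ ⟨x, hx, rfl⟩; exact hP.snd_mem x hx) A hAsub
  have hbP' : ∀ x ∈ P, x.2 ≠ b := fun x hx h => hbP ⟨x, hx, h⟩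
  have haP' : ∀ x ∈ P, x.1 ≠ a := by
    rintro ⟨x, y⟩ hx rfl
    exact hdom y hx
  have key : ∀ q : Finset (ℕ × ℕ), (q : Set (ℕ × ℕ)) ⊆ P →
      (insert a (q.image Prod.fst) ∈ X.faces ↔ insert b (q.image Prod.snd) ∈ Y.faces) := by
    intro q hq
    rcases q.eq_empty_or_nonempty with rfl | hne
    · exact ⟨fun _ => hbY, fun _ => ha⟩
    constructor
    · intro h
      have hA : q.image Prod.snd ∈ A.faces := ⟨by simpa using hne, q, hq, rfl, h⟩
      rw [← hb] at hA
      exact hA.1.2.2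
    · intro h
      have hqY : q.image Prod.snd ∈ Y.faces :=
        Y.down_closed _ h _ (Finset.subset_insert _ _) (by simpa using hne)
      have hA : q.image Prod.snd ∈ A.faces := by
        rw [← hb]
        refine ⟨⟨hqY, ?_, h⟩, hqY, ?_⟩
        · intro hmem
          obtain ⟨x, hx, hxb⟩ := Finset.mem_image.1 hmem
          exact hbP' x (hq hx) hxb
        · rw [Finset.coe_image]
          exact Set.image_mono hq
      obtain ⟨-, q', hq', heq, hX⟩ := hA
      have : q' = q := by
        have aux : ∀ q₁ q₂ : Finset (ℕ × ℕ), (q₁ : Set (ℕ × ℕ)) ⊆ P → (q₂ : Set (ℕ × ℕ)) ⊆ P →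
            q₁.image Prod.snd = q₂.image Prod.snd → q₁ ⊆ q₂ := by
          intro q₁ q₂ h₁ h₂ h x hx
          have hx' : x.2 ∈ q₂.image Prod.snd := h ▸ Finset.mem_image_of_mem _ hx
          obtain ⟨y, hy, hyx⟩ := Finset.mem_image.1 hx'
          have := (hP.fst_eq_iff y (h₂ hy) x (h₁ hx)).2 hyx
          rwa [← Prod.ext this hyx]
        exact (aux q' q hq' hq heq).antisymm (aux q q' hq hq' heq.symm)
      rwa [this] at hX
  refine ⟨insert (a, b) P, Set.subset_insert _ _, hfin.insert _, ⟨?_, ?_, ?_, ?_⟩, b,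
    Set.mem_insert _ _⟩
  · rintro x (rfl | hx)
    exacts [ha, hP.fst_mem x hx]
  · rintro x (rfl | hx)
    exacts [hbY, hP.snd_mem x hx]
  · rintro x (rfl | hx) y (rfl | hy)
    · simp
    · simp [(haP' y hy).symm, (hbP' y hy).symm]
    · simp [haP' x hx, hbP' x hx]
    · exact hP.fst_eq_iff x hx y hy
  · intro q hq
    by_cases hab : (a, b) ∈ q
    · have hsub : ((q.erase (a, b) : Finset (ℕ × ℕ)) : Set (ℕ × ℕ)) ⊆ P := by
        intro x hx
        obtain ⟨hxne, hxq⟩ := Finset.mem_erase.1 (Finset.mem_coe.1 hx)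
        exact (hq hxq).resolve_left hxne
      have := key _ hsub
      rwa [← Finset.insert_erase hab, Finset.image_insert, Finset.image_insert]
    · refine hP.image_mem_iff q fun x hx => (hq hx).resolve_left ?_
      rintro rfl
      exact hab hx

lemma IsPartialIso.exists_extend_snd (hX : AmpleProp X) {P : Set (ℕ × ℕ)}
    (hP : IsPartialIso X Y P) (hfin : P.Finite) {b : ℕ} (hb : b ∈ Y.vertexSet) :
    ∃ Q, P ⊆ Q ∧ Q.Finite ∧ IsPartialIso X Y Q ∧ ∃ a, (a, b) ∈ Q := by
  obtain ⟨Q, hPQ, hQ, hQiso, a, ha⟩ := hP.swap.exists_extend_fst hX (hfin.image _) hb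
  refine ⟨Prod.swap '' Q, ?_, hQ.image _, hQiso.swap, a, (b, a), ha, rfl⟩
  intro x hx
  exact ⟨x.swap, hPQ ⟨x, hx, rfl⟩, Prod.swap_swap x⟩

lemma IsPartialIso.iUnion {P : ℕ → Set (ℕ × ℕ)} (hmono : Monotone P)
    (hP : ∀ n, IsPartialIso X Y (P n)) : IsPartialIso X Y (⋃ n, P n) where
  fst_mem := by
    intro x hx
    obtain ⟨n, hn⟩ := Set.mem_iUnion.1 hx
    exact (hP n).fst_mem x hn
  snd_mem := by
    intro x hx
    obtain ⟨n, hn⟩ := Set.mem_iUnion.1 hx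
    exact (hP n).snd_mem x hn
  fst_eq_iff := by
    intro x hx y hy
    obtain ⟨n, hn⟩ := Set.mem_iUnion.1 hx
    obtain ⟨m, hm⟩ := Set.mem_iUnion.1 hy
    exact (hP (max n m)).fst_eq_iff x (hmono (le_max_left _ _) hn) y
      (hmono (le_max_right _ _) hm)
  image_mem_iff := by
    intro q hq
    obtain ⟨n, hn⟩ := hmono.directed_le.exists_mem_subset_of_finset_subset_biUnion hq
    exact (hP n).image_mem_iff q hn

/-- Back-and-forth: a finite partial isomorphism into an ample complex extends to one defined
on all vertices, and it can be made onto if the source is ample as well. -/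
lemma IsPartialIso.exists_total (hY : AmpleProp Y) {P : Set (ℕ × ℕ)}
    (hP : IsPartialIso X Y P) (hfin : P.Finite) :
    ∃ Q, P ⊆ Q ∧ IsPartialIso X Y Q ∧ (∀ a ∈ X.vertexSet, ∃ b, (a, b) ∈ Q) ∧
      (AmpleProp X → ∀ b ∈ Y.vertexSet, ∃ a, (a, b) ∈ Q) := by
  have step : ∀ (n : ℕ) (R : {R : Set (ℕ × ℕ) // R.Finite ∧ IsPartialIso X Y R}),
      ∃ S : {R : Set (ℕ × ℕ) // R.Finite ∧ IsPartialIso X Y R}, R.1 ⊆ S.1 ∧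
        (n ∈ X.vertexSet → ∃ b, (n, b) ∈ S.1) ∧
        (AmpleProp X → n ∈ Y.vertexSet → ∃ a, (a, n) ∈ S.1) := by
    rintro n ⟨R, hRfin, hR⟩
    obtain ⟨S, hRS, hSfin, hS, hSn⟩ : ∃ S, R ⊆ S ∧ S.Finite ∧ IsPartialIso X Y S ∧
        (n ∈ X.vertexSet → ∃ b, (n, b) ∈ S) := by
      by_cases hn : n ∈ X.vertexSet
      · obtain ⟨S, h₁, h₂, h₃, h₄⟩ := hR.exists_extend_fst hY hRfin hn
        exact ⟨S, h₁, h₂, h₃, fun _ => h₄⟩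
      · exact ⟨R, subset_rfl, hRfin, hR, fun h => absurd h hn⟩
    by_cases hn : AmpleProp X ∧ n ∈ Y.vertexSet
    · obtain ⟨T, h₁, h₂, h₃, h₄⟩ := hS.exists_extend_snd hn.1 hSfin hn.2
      exact ⟨⟨T, h₂, h₃⟩, hRS.trans h₁, fun h => (hSn h).imp fun b hb => h₁ hb,
        fun _ _ => h₄⟩
    · exact ⟨⟨S, hSfin, hS⟩, hRS, hSn, fun h₁ h₂ => absurd ⟨h₁, h₂⟩ hn⟩
  choose next hsub hfst hsnd using step
  let p : ℕ → {R : Set (ℕ × ℕ) // R.Finite ∧ IsPartialIso X Y R} :=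
    fun n => Nat.rec ⟨P, hfin, hP⟩ next n
  have hmono : Monotone fun n => (p n).1 := monotone_nat_of_le_succ fun n => hsub n (p n)
  refine ⟨⋃ n, (p n).1, Set.subset_iUnion (fun n => (p n).1) 0,
    IsPartialIso.iUnion hmono fun n => (p n).2.2, ?_, ?_⟩
  · intro a ha
    obtain ⟨b, hb⟩ := hfst a (p a) ha
    exact ⟨b, Set.mem_iUnion.2 ⟨a + 1, hb⟩⟩
  · intro hX b hb
    obtain ⟨a, ha⟩ := hsnd b (p b) hX hb
    exact ⟨a, Set.mem_iUnion.2 ⟨b + 1, ha⟩⟩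

lemma IsPartialIso.mem_faces_iff {P : Set (ℕ × ℕ)} (hP : IsPartialIso X Y P) {f : ℕ → ℕ}
    {s : Finset ℕ} (hf : ∀ a ∈ s, (a, f a) ∈ P) : s ∈ X.faces ↔ s.image f ∈ Y.faces := by
  have h := hP.image_mem_iff (s.image fun a => (a, f a)) (by
    intro x hx
    obtain ⟨a, ha, rfl⟩ := Finset.mem_image.1 (Finset.mem_coe.1 hx)
    exact hf a ha)
  simpa [Finset.image_image, Function.comp_def] using h

lemma IsPartialIso.injOn {P : Set (ℕ × ℕ)} (hP : IsPartialIso X Y P) {f : ℕ → ℕ}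
    {s : Set ℕ} (hf : ∀ a ∈ s, (a, f a) ∈ P) : Set.InjOn f s := fun a ha b hb hab =>
  (hP.fst_eq_iff _ (hf a ha) _ (hf b hb)).2 hab

lemma AmpleProp.universal (hX : AmpleProp X) : Universal X := by
  intro Y _
  have h0 : IsPartialIso Y X ∅ := by
    refine ⟨by simp, by simp, by simp, fun q hq => ?_⟩
    obtain rfl : q = ∅ := by simpa using hq
    simp only [Finset.image_empty]
    exact ⟨fun h => absurd (Y.nonempty_of_mem _ h) (by simp),
      fun h => absurd (X.nonempty_of_mem _ h) (by simp)⟩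
  obtain ⟨Q, -, hQ, htot, -⟩ := h0.exists_total hX Set.finite_empty
  choose! f hf using htot
  have hsub : f '' Y.vertexSet ⊆ X.vertexSet := by
    rintro _ ⟨a, ha, rfl⟩
    exact hQ.snd_mem _ (hf a ha)
  refine ⟨f '' Y.vertexSet, hsub, f, ?_, fun s hs => ?_⟩
  · rw [vertexSet_induced hsub]
    exact (hQ.injOn hf).bijOn_image
  · rw [hQ.mem_faces_iff fun a ha => hf a (hs ha)]
    refine ⟨fun h => ⟨h, ?_⟩, fun h => h.1⟩
    rw [Finset.coe_image]
    exact Set.image_mono hs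

lemma AmpleProp.homogeneous (hX : AmpleProp X) : Homogeneous X := by
  intro U U' hU _ hUX hU'X f hf
  have hbij := hf.1
  rw [vertexSet_induced hUX, vertexSet_induced hU'X] at hbij
  have h0 : IsPartialIso X X ((fun a => (a, f a)) '' U) := by
    refine ⟨?_, ?_, ?_, fun q hq => ?_⟩
    · rintro _ ⟨a, ha, rfl⟩
      exact hUX ha
    · rintro _ ⟨a, ha, rfl⟩
      exact hU'X (hbij.mapsTo ha)
    · rintro _ ⟨a, ha, rfl⟩ _ ⟨b, hb, rfl⟩
      exact (hbij.injOn.eq_iff ha hb).symm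
    · have hqU : ((q.image Prod.fst : Finset ℕ) : Set ℕ) ⊆ U := by
        intro a ha
        obtain ⟨x, hx, rfl⟩ := Finset.mem_image.1 (Finset.mem_coe.1 ha)
        obtain ⟨b, hb, rfl⟩ := hq hx
        exact hb
      have himg : q.image Prod.snd = (q.image Prod.fst).image f := by
        rw [Finset.image_image]
        refine Finset.image_congr fun x hx => ?_
        obtain ⟨b, hb, rfl⟩ := hq hx
        rfl
      rw [himg, ← hf.mem_faces_iff ((vertexSet_induced hUX).symm ▸ hqU)]
      exact ⟨fun h => ⟨h, hqU⟩, fun h => h.1⟩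
  obtain ⟨Q, hPQ, hQ, htot, hsurj⟩ := h0.exists_total hX (hU.image _)
  choose! F hF using htot
  refine ⟨F, ⟨⟨fun a ha => hQ.snd_mem _ (hF a ha), hQ.injOn hF, fun b hb => ?_⟩,
    fun s hs => hQ.mem_faces_iff fun a ha => hF a (hs ha)⟩, fun a ha => ?_⟩
  · obtain ⟨a, ha⟩ := hsurj hX b hb
    have haX := hQ.fst_mem _ ha
    exact ⟨a, haX, (hQ.fst_eq_iff _ (hF a haX) _ ha).1 rfl⟩
  · exact (hQ.fst_eq_iff _ (hF a (hUX ha)) _ (hPQ ⟨a, ha, rfl⟩)).1 rfl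

lemma AmpleProp.isRado (hX : AmpleProp X) : X.IsRado :=
  ⟨Set.to_countable _, hX.universal, hX.homogeneous⟩

/-- The union of two simplicial complexes. -/
def union (A B : SComplex) : SComplex where
  faces := A.faces ∪ B.faces
  nonempty_of_mem := fun s hs => hs.elim (A.nonempty_of_mem s) (B.nonempty_of_mem s)
  down_closed := fun s hs t hts ht => hs.imp (fun h => A.down_closed s h t hts ht)
    (fun h => B.down_closed s h t hts ht)

/-- The complex induced on the vertices with prescribed link over a finite set is ample. -/
lemma AmpleProp.induced_link (hX : AmpleProp X) {U : Set ℕ} (hUfin : U.Finite)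
    (hUsub : U ⊆ X.vertexSet) {A : SComplex} (hA : A.faces ⊆ (X.induced U).faces) :
    AmpleProp (X.induced {v | v ∈ X.vertexSet ∧ v ∉ U ∧
      (X.link v).faces ∩ (X.induced U).faces = A.faces}) := by
  set Z := {v | v ∈ X.vertexSet ∧ v ∉ U ∧
      (X.link v).faces ∩ (X.induced U).faces = A.faces}
  have hZX : Z ⊆ X.vertexSet := fun v hv => hv.1
  intro V hVfin hV B hB
  rw [vertexSet_induced hZX] at hV ⊢
  have hB' : B.faces ⊆ (X.induced V).faces := fun s hs => ⟨(hB hs).1.1, (hB hs).2⟩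
  have hAB : (A.union B).faces ⊆ (X.induced (U ∪ V)).faces := by
    rintro s (hs | hs)
    · exact ⟨(hA hs).1, (hA hs).2.trans Set.subset_union_left⟩
    · exact ⟨(hB' hs).1, (hB' hs).2.trans Set.subset_union_right⟩
  obtain ⟨v, ⟨hvX, hvUV⟩, hv⟩ := hX (U ∪ V) (hUfin.union hVfin)
    (Set.union_subset hUsub (hV.trans hZX)) _ hAB
  have hdisj : ∀ s : Finset ℕ, s.Nonempty → (s : Set ℕ) ⊆ U → ¬ (s : Set ℕ) ⊆ V := by
    rintro s ⟨a, ha⟩ h₁ h₂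
    exact (hV (h₂ ha)).2.1 (h₁ ha)
  have hvZ : v ∈ Z := by
    refine ⟨hvX, fun h => hvUV (Or.inl h), Set.ext fun s => ⟨?_, fun hs => ?_⟩⟩
    · rintro ⟨hs, hsU⟩
      have : s ∈ (A.union B).faces := hv ▸ ⟨hs, hsU.1, hsU.2.trans Set.subset_union_left⟩
      exact this.resolve_right fun h => hdisj s (X.nonempty_of_mem _ hs.1) hsU.2 (hB' h).2
    · have : s ∈ (A.union B).faces := Or.inl hs
      rw [← hv] at this
      exact ⟨this.1, hA hs⟩
  refine ⟨v, ⟨hvZ, fun h => hvUV (Or.inr h)⟩, Set.ext fun s => ⟨?_, fun hs => ?_⟩⟩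
  · rintro ⟨hs, hsV⟩
    have : s ∈ (A.union B).faces :=
      hv ▸ ⟨⟨hs.1.1, hs.2.1, hs.2.2.1⟩, hsV.1.1, hsV.2.trans Set.subset_union_right⟩
    exact this.resolve_left fun h => hdisj s (X.nonempty_of_mem _ hs.1.1) (hA h).2 hsV.2
  · have : s ∈ (A.union B).faces := Or.inr hs
    rw [← hv] at this
    refine ⟨⟨(hB hs).1, this.1.2.1, this.1.2.2, ?_⟩, hB hs⟩
    rw [Finset.coe_insert]
    exact Set.insert_subset hvZ (hB hs).1.2

lemma AmpleProp.infinite_vertexSet (hX : AmpleProp X) : X.vertexSet.Infinite := by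
  intro hfin
  obtain ⟨v, hv, -⟩ := hX _ hfin subset_rfl ⟨∅, by simp, by simp⟩ (Set.empty_subset _)
  exact hv.2 hv.1

end SComplex

/-- For a Rado complex `X`, a finite `U ⊆ V(X)` and a subcomplex
`A ⊆ X_U`, the set `Z_{U,A}` of vertices `v ∈ V(X) − U` with `Lk_X(v) ∩ X_U = A`
is infinite and the subcomplex induced on it is again a Rado complex. -/
theorem rado_Z_infinite_and_rado (X : SComplex) (hX : X.IsRado)
    (U : Set ℕ) (hUfin : U.Finite) (hUsub : U ⊆ X.vertexSet)
    (A : SComplex) (hA : A.faces ⊆ (X.induced U).faces)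
    (Z : Set ℕ)
    (hZ : Z = {v | v ∈ X.vertexSet ∧ v ∉ U ∧
      (X.link v).faces ∩ (X.induced U).faces = A.faces}) :
    Z.Infinite ∧ (X.induced Z).IsRado := by
  subst hZ
  have h := hX.ampleProp.induced_link hUfin hUsub hA
  refine ⟨?_, h.isRado⟩
  rw [← SComplex.vertexSet_induced (X := X) (U := {v | v ∈ X.vertexSet ∧ v ∉ U ∧
    (X.link v).faces ∩ (X.induced U).faces = A.faces}) fun v hv => hv.1]
  exact h.infinite_vertexSet
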